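/- The dynamical system (X, G_{f₀}) is unstable: for every x ∈ X the orbit γ_x : n ↦ G_{f₀}^n(x) is unstable, i.e., there exists ε > 0 such that for every δ > 0 there exist y ∈ X and n ∈ ℕ with d(x,y) < δ and d(G_{f₀}^n(x), G_{f₀}^n(y)) ≥ ε. -/

import Mathlib

open scoped BigOperators

/-- Sum of the discrete Boolean metric over the `N` coordinates (Hamming-type distance). -/
noncomputable def de (N : ℕ) (E F : Fin N → Bool) : ℝ :=
  ∑ k : Fin N, if E k = F k then (0 : ℝ) else 1

/-- Distance between strategies: `(9/N) Σ_k |S^k − Š^k| / 10^k`. -/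
noncomputable def ds (N : ℕ) (S T : ℕ → Fin N) : ℝ :=
  (9 / N) * ∑' k : ℕ, |((S k : ℕ) : ℝ) - ((T k : ℕ) : ℝ)| / 10 ^ (k + 1)

/-- The distance on the phase space `X = {1,…,N}^ℕ × B^N`. -/
noncomputable def dX (N : ℕ) (x y : (ℕ → Fin N) × (Fin N → Bool)) : ℝ :=
  de N x.2 y.2 + ds N x.1 y.1

/-- `F_f(k,E)` agrees with `E` except in coordinate `k`, where it equals `f(E)_k`. -/
def Ff (N : ℕ) (f : (Fin N → Bool) → (Fin N → Bool)) (k : Fin N) (E : Fin N → Bool) :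
    Fin N → Bool :=
  fun j => if j = k then f E k else E j

/-- `G_f(S,E) = (σ(S), F_f(S^1,E))`, where `σ` is the shift on strategies. -/
def G (N : ℕ) (f : (Fin N → Bool) → (Fin N → Bool))
    (x : (ℕ → Fin N) × (Fin N → Bool)) : (ℕ → Fin N) × (Fin N → Bool) :=
  (fun n => x.1 (n + 1), Ff N f (x.1 0) x.2)

/-- The vectorial negation `f₀`. -/
def f0 (N : ℕ) (E : Fin N → Bool) : Fin N → Bool := fun i => !(E i)

/-- A set is open for the metric `dX`. -/
def dOpen (N : ℕ) (U : Set ((ℕ → Fin N) × (Fin N → Bool))) : Prop :=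
  ∀ x ∈ U, ∃ ε > 0, ∀ y, dX N x y < ε → y ∈ U

/-- A set is closed for the metric `dX`. -/
def dClosed (N : ℕ) (A : Set ((ℕ → Fin N) × (Fin N → Bool))) : Prop :=
  dOpen N Aᶜ


theorem one_le_de_of_ne {N : ℕ} {E F : Fin N → Bool} {k : Fin N} (h : E k ≠ F k) :
    1 ≤ de N E F := by
  have key := Finset.single_le_sum (f := fun k => if E k = F k then (0 : ℝ) else 1)
    (fun i _ => by split_ifs <;> norm_num) (Finset.mem_univ k)
  simpa [h, de] using key

theorem de_self (N : ℕ) (E : Fin N → Bool) : de N E E = 0 := by simp [de]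

theorem ds_nonneg (N : ℕ) (S T : ℕ → Fin N) : 0 ≤ ds N S T :=
  mul_nonneg (by positivity) (tsum_nonneg fun _ => by positivity)

/-- Modifying a single term of a strategy moves it by at most `9 / 10 ^ (m + 1)`. -/
theorem ds_update_le {N : ℕ} (S : ℕ → Fin N) (m : ℕ) (j : Fin N) :
    ds N S (Function.update S m j) ≤ 9 / 10 ^ (m + 1) := by
  have hN : (0 : ℝ) < N := by exact_mod_cast j.pos
  have hle : |((S m : ℕ) : ℝ) - ((j : ℕ) : ℝ)| ≤ N := by
    have h1 : ((S m : ℕ) : ℝ) < N := by exact_mod_cast (S m).isLt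
    have h2 : ((j : ℕ) : ℝ) < N := by exact_mod_cast j.isLt
    have h3 : (0 : ℝ) ≤ (S m : ℕ) := Nat.cast_nonneg _
    have h4 : (0 : ℝ) ≤ (j : ℕ) := Nat.cast_nonneg _
    rw [abs_le]
    constructor <;> linarith
  rw [ds, tsum_eq_single m fun k hk => by simp [Function.update_of_ne hk],
    Function.update_self]
  calc 9 / (N : ℝ) * (|((S m : ℕ) : ℝ) - ((j : ℕ) : ℝ)| / 10 ^ (m + 1))
      ≤ 9 / (N : ℝ) * (N / 10 ^ (m + 1)) := by gcongr
    _ = 9 / 10 ^ (m + 1) := by field_simp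

theorem G_iterate_fst {N : ℕ} (f : (Fin N → Bool) → (Fin N → Bool))
    (x : (ℕ → Fin N) × (Fin N → Bool)) (n k : ℕ) : ((G N f)^[n] x).1 k = x.1 (k + n) := by
  induction n generalizing k with
  | zero => rfl
  | succ n ih =>
    rw [Function.iterate_succ_apply']
    simp only [G, ih, Nat.add_assoc, Nat.add_comm 1 n]

/-- The Boolean state after `n` steps depends only on the first `n` terms of the strategy. -/
theorem G_iterate_snd_congr {N : ℕ} (f : (Fin N → Bool) → (Fin N → Bool))
    {x y : (ℕ → Fin N) × (Fin N → Bool)} (h2 : x.2 = y.2) (n : ℕ)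
    (h1 : ∀ k < n, x.1 k = y.1 k) : ((G N f)^[n] x).2 = ((G N f)^[n] y).2 := by
  induction n with
  | zero => exact h2
  | succ n ih =>
    rw [Function.iterate_succ_apply', Function.iterate_succ_apply']
    simp only [G, G_iterate_fst, ih fun k hk => h1 k (by omega), Nat.zero_add,
      h1 n (Nat.lt_succ_self n)]

/-- The dynamical system `(X, G_{f₀})` is unstable: every orbit is unstable. -/
theorem Gf0_unstable (N : ℕ) (hN : 2 ≤ N) :
    ∀ x : (ℕ → Fin N) × (Fin N → Bool), ∃ ε > (0 : ℝ), ∀ δ > (0 : ℝ),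
      ∃ y : (ℕ → Fin N) × (Fin N → Bool), ∃ n : ℕ,
        dX N x y < δ ∧ ε ≤ dX N ((G N (f0 N))^[n] x) ((G N (f0 N))^[n] y) := by
  intro x
  refine ⟨1, one_pos, fun δ hδ => ?_⟩
  obtain ⟨m, hm⟩ := exists_pow_lt_of_lt_one (show 0 < δ / 9 by positivity)
    (show (1 / 10 : ℝ) < 1 by norm_num)
  have : Nontrivial (Fin N) := Fin.nontrivial_iff_two_le.mpr hN
  obtain ⟨j, hj⟩ := exists_ne (x.1 m)
  refine ⟨(Function.update x.1 m j, x.2), m + 1, ?_, ?_⟩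
  · have hs : (9 : ℝ) / 10 ^ (m + 1) ≤ 9 * (1 / 10) ^ m := by
      rw [one_div, inv_pow, ← div_eq_mul_inv]
      gcongr <;> norm_num
    have hu := ds_update_le x.1 m j
    rw [dX, de_self]
    dsimp only
    linarith
  · have hE := G_iterate_snd_congr (f0 N) (x := x) (y := (Function.update x.1 m j, x.2)) rfl m
      fun k hk => (Function.update_of_ne hk.ne _ _).symm
    have hne : ((G N (f0 N))^[m + 1] x).2 j ≠
        ((G N (f0 N))^[m + 1] (Function.update x.1 m j, x.2)).2 j := by
      rw [Function.iterate_succ_apply', Function.iterate_succ_apply']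
      simp [G, Ff, f0, G_iterate_fst, hE, hj]
    have h1 := one_le_de_of_ne hne
    have h2 := ds_nonneg N ((G N (f0 N))^[m + 1] x).1
      ((G N (f0 N))^[m + 1] (Function.update x.1 m j, x.2)).1
    rw [dX]
    linarith
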